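/- arXiv:1904.03104 — 4 statements merged into one kernel-verified Lean document; each statement's English description precedes it below -/
import Mathlib

section
/- Let q be an odd prime power and let δ ∈ F_{q^8} satisfy δ² = −1. Then C₂ = ⟨x, δx^q + x^{q^5}⟩_{F_{q^8}} is an F_q-linear MRD code with parameters (8,8,q;7); equivalently, every nonzero q-polynomial of the form α x + β(δ x^q + x^{q^5}) with α, β ∈ F_{q^8} has rank at least 7 as an F_q-linear map of F_{q^8}. -/
/-! Basic definitions for linearized polynomials (`q`-polynomials) over a finite
field extension `F` of `Fq`, represented by their coefficient vectors
`a : Fin n → F`, corresponding to `x ↦ ∑ i, a i * x ^ (q ^ i)` with `q = |Fq|`. -/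

section QPolyDefs

variable (Fq : Type*) [Field Fq] [Fintype Fq] {F : Type*} [Field F] [Fintype F]

/-- The map `F → F` given by the `q`-polynomial with coefficient vector `a`. -/
def qeval {n : ℕ} (a : Fin n → F) : F → F :=
  fun x => ∑ i : Fin n, a i * x ^ (Fintype.card Fq) ^ (i : ℕ)

/-- The rank of the `q`-polynomial with coefficient vector `a`, i.e. the rank of the
corresponding `Fq`-linear map `F → F`. -/
noncomputable def qrank [Algebra Fq F] {n : ℕ} (a : Fin n → F) : ℕ :=
  Module.finrank Fq (Submodule.span Fq (Set.range (qeval Fq a)))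

/-- Composition of `q`-polynomials (reduced mod `x^(q^n) - x`), on coefficient vectors. -/
def qcomp {n : ℕ} (a b : Fin n → F) : Fin n → F :=
  fun k => ∑ i : Fin n, a i * (b (k - i)) ^ (Fintype.card Fq) ^ (i : ℕ)

variable (F) in
/-- The identity `q`-polynomial `x`. -/
def qone (n : ℕ) : Fin n → F :=
  fun j => if (j : ℕ) = 0 then 1 else 0

/-- The adjoint of a `q`-polynomial: `∑ aᵢ x^(q^i) ↦ ∑ aᵢ^(q^(n-i)) x^(q^(n-i))`. -/
def qadjoint {n : ℕ} (a : Fin n → F) : Fin n → F :=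
  fun j => (a ⟨(n - (j : ℕ)) % n, Nat.mod_lt _ j.pos⟩) ^ (Fintype.card Fq) ^ (j : ℕ)

/-- The Delsarte dual of a code of `q`-polynomials, with respect to the bilinear form
`b(f,g) = Tr_{q^n/q}(∑ fᵢ gᵢ)`. -/
def qperp [Algebra Fq F] {n : ℕ} (C : Set (Fin n → F)) : Set (Fin n → F) :=
  {a | ∀ b ∈ C, Algebra.trace Fq F (∑ i : Fin n, a i * b i) = 0}

/-- Equivalence of codes of `q`-polynomials: `C' = {u ∘ f^σ ∘ v : f ∈ C}` for invertible
`q`-polynomials `u, v` and a field automorphism `σ`. -/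
def CodeEquiv {n : ℕ} (C C' : Set (Fin n → F)) : Prop :=
  ∃ (u v : Fin n → F) (σ : F ≃+* F),
    Function.Bijective (qeval Fq u) ∧ Function.Bijective (qeval Fq v) ∧
    C' = (fun a => qcomp Fq u (qcomp Fq (fun i => σ (a i)) v)) '' C

/-- The left idealiser of a code of `q`-polynomials. -/
def leftIdealiser {n : ℕ} (C : Set (Fin n → F)) : Set (Fin n → F) :=
  {φ | ∀ f ∈ C, qcomp Fq φ f ∈ C}

/-- The right idealiser of a code of `q`-polynomials. -/
def rightIdealiser {n : ℕ} (C : Set (Fin n → F)) : Set (Fin n → F) :=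
  {φ | ∀ f ∈ C, qcomp Fq f φ ∈ C}

variable (F) in
/-- The code `F_n = {x ↦ αx : α ∈ F_{q^n}}` of scalar maps. -/
def scalarCode (n : ℕ) : Set (Fin n → F) :=
  Set.range (fun α : F => fun j : Fin n => if (j : ℕ) = 0 then α else 0)

variable (F) in
/-- The generalized Gabidulin code `G_{k,s} = ⟨x, x^(q^s), …, x^(q^(s(k-1)))⟩_{F_{q^n}}`. -/
def Gcode (n s k : ℕ) : Set (Fin n → F) :=
  {a | ∃ c : Fin k → F, a = fun j : Fin n => ∑ i : Fin k, if (j : ℕ) = (s * (i : ℕ)) % n then c i else 0}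

/-- The generalized twisted Gabidulin code
`H_{k,s}(η,h) = {a₀x + a₁x^(q^s) + ⋯ + a_{k-1}x^(q^(s(k-1))) + a₀^(q^h) η x^(q^(sk))}`. -/
def Hcode (n s k : ℕ) (h : ℤ) (η : F) : Set (Fin n → F) :=
  {a | ∃ c : Fin k → F, a = fun j : Fin n =>
    (∑ i : Fin k, if (j : ℕ) = (s * (i : ℕ)) % n then c i else 0) +
    (if hk : 0 < k then
      (if (j : ℕ) = (s * k) % n then
        η * (c ⟨0, hk⟩) ^ (Fintype.card Fq) ^ (h % (n : ℤ)).toNat else 0)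
    else 0)}

/-- Coefficientwise `q^m`-th power of a `q`-polynomial: `f ↦ f^{[m]}`. -/
def frobvec {n : ℕ} (m : ℕ) (a : Fin n → F) : Fin n → F :=
  fun i => (a i) ^ (Fintype.card Fq) ^ m

/-- `C^{[m]} = {f^{[m]} : f ∈ C}`. -/
def frobCode {n : ℕ} (m : ℕ) (C : Set (Fin n → F)) : Set (Fin n → F) :=
  frobvec Fq m '' C

/-- `S` is a finite field under addition and composition of `q`-polynomials. -/
def IsSubfieldCode {n : ℕ} (S : Set (Fin n → F)) : Prop :=
  (0 : Fin n → F) ∈ S ∧ qone F n ∈ S ∧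
  (∀ a ∈ S, ∀ b ∈ S, a + b ∈ S) ∧
  (∀ a ∈ S, -a ∈ S) ∧
  (∀ a ∈ S, ∀ b ∈ S, qcomp Fq a b ∈ S) ∧
  (∀ a ∈ S, ∀ b ∈ S, qcomp Fq a b = qcomp Fq b a) ∧
  (∀ a ∈ S, a ≠ 0 → ∃ b ∈ S, qcomp Fq a b = qone F n)

end QPolyDefs

theorem qaux_core {F : Type*} [Field F] (s : F →+* F) (h8 : ∀ x, s (s (s (s (s (s (s (s x))))))) = x)
    (h2 : (2 : F) ≠ 0) (δ : F) (hδ : δ ^ 2 = -1) (x l : F) (hx : x ≠ 0)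
    (h : δ * s (l * x) + s (s (s (s (s (l * x))))) = l * (δ * s x + s (s (s (s (s x)))))) :
    s l = l := by
  have hd : s (s (s (s δ))) = δ := by
    have h1 : (s δ) ^ 2 = δ ^ 2 := by rw [← map_pow, hδ]; simp
    rcases sq_eq_sq_iff_eq_or_eq_neg.1 h1 with e | e <;> simp [e]
  have e1 := h
  have e2 := congrArg (fun z => s (s (s (s z)))) h
  simp only [map_mul, map_add, hd, h8] at e1 e2
  have hx1 : s x ≠ 0 := by simpa using hx
  have hx5 : s (s (s (s (s x)))) ≠ 0 := by simpa using hx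
  generalize hA1 : s l = b at *
  generalize hA2 : s b = b2 at *
  generalize hA3 : s b2 = b3 at *
  generalize hA4 : s b3 = c at *
  generalize hA5 : s c = d at *
  generalize hA6 : s d = d2 at *
  generalize hA7 : s d2 = d3 at *
  have hA8 : s d3 = l := by rw [← hA7, ← hA6, ← hA5, ← hA4, ← hA3, ← hA2, ← hA1, h8]
  have key : -((b - l) * (d - c)) = (l - d) * (c - b) := by
    have f1 : δ * (b - l) * s x = (l - d) * s (s (s (s (s x)))) := by linear_combination e1
    have f2 : δ * (d - c) * s (s (s (s (s x)))) = (c - b) * s x := by linear_combination e2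
    apply mul_right_cancel₀ (mul_ne_zero hx1 hx5)
    have := congrArg₂ (· * ·) f1 f2
    linear_combination this - (b - l) * (d - c) * s x * s (s (s (s (s x)))) * hδ
  -- `S = T - T^s`, `u = l - c`
  obtain ⟨S, hS⟩ : ∃ S, S = (l + c) - (b + d) := ⟨_, rfl⟩
  obtain ⟨u, hu⟩ : ∃ u, u = l - c := ⟨_, rfl⟩
  have k0 : S ^ 2 = u ^ 2 + (s u) ^ 2 := by
    rw [hS, hu]; simp only [map_sub, hA1, hA5]
    linear_combination -2 * key
  have k1 := congrArg s k0
  have k2 := congrArg s k1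
  have k3 := congrArg s k2
  have u4 : s (s (s (s u))) = - u := by
    rw [hu]; simp only [map_sub, *]; ring
  have tr : S + s S + s (s S) + s (s (s S)) = 0 := by
    rw [hS]; simp only [map_sub, map_add, *]; ring
  have S4 : s (s (s (s S))) = S := by
    rw [hS]; simp only [map_sub, map_add, *]; ring
  simp only [map_add, map_pow, u4] at k1 k2 k3
  have fac : (S + s S) * (S + s (s (s S))) = 0 := by
    apply mul_left_cancel₀ h2
    linear_combination (S - s (s S) + s S + s (s (s S))) * tr + k0 - k1 + k2 - k3
  have Sneg : s S = - S := by
    rcases mul_eq_zero.1 fac with e | e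
    · linear_combination e
    · have := congrArg s e
      simp only [map_add, S4, map_zero] at this
      linear_combination this
  have u2 : (s (s u)) ^ 2 = u ^ 2 := by
    rw [Sneg] at k1
    linear_combination k0 - k1
  have u0 : u = 0 := by
    have : s (s (s (s u))) = u := by
      rcases sq_eq_sq_iff_eq_or_eq_neg.1 u2 with e | e <;> simp [e]
    apply mul_left_cancel₀ h2
    linear_combination u4 - this
  have S0 : S = 0 := by
    rw [u0] at k0; simpa using k0
  have lc : c = l := by linear_combination hu - u0
  have bd : d = b := by rw [← hA5, lc, hA1]
  apply mul_left_cancel₀ h2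
  rw [S0, lc, bd] at hS
  linear_combination hS

theorem qaux_fixed (Fq F : Type*) [Field Fq] [Fintype Fq] [Field F] [Algebra Fq F]
    (l : F) (h : l ^ Fintype.card Fq = l) : ∃ c : Fq, algebraMap Fq F c = l := by
  classical
  have h0 : (Polynomial.X ^ Fintype.card Fq - Polynomial.X : Polynomial F) ≠ 0 :=
    FiniteField.X_pow_card_sub_X_ne_zero F Fintype.one_lt_card
  have hsub : Finset.univ.image (algebraMap Fq F) ⊆
      (Polynomial.X ^ Fintype.card Fq - Polynomial.X : Polynomial F).roots.toFinset := by
    intro y hy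
    obtain ⟨c, -, rfl⟩ := Finset.mem_image.1 hy
    simp [h0, ← map_pow, FiniteField.pow_card]
  have heq := Finset.eq_of_subset_of_card_le hsub (by
    rw [Finset.card_image_of_injective _ (algebraMap Fq F).injective, Finset.card_univ]
    refine (Multiset.toFinset_card_le _).trans ((Polynomial.card_roots' _).trans ?_)
    rw [FiniteField.X_pow_card_sub_X_natDegree_eq F Fintype.one_lt_card])
  have : l ∈ (Polynomial.X ^ Fintype.card Fq - Polynomial.X : Polynomial F).roots.toFinset := by
    simp [h0, h]
  rw [← heq] at this
  obtain ⟨c, -, hc⟩ := Finset.mem_image.1 this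
  exact ⟨c, hc⟩

/-- Csajbók–Marino–Polverino–Zanella: for `q` odd and `δ ∈ F_{q⁸}`
with `δ² = −1`, the code `C₂ = ⟨x, δx^q + x^{q⁵}⟩_{F_{q⁸}}` is an MRD code with
parameters `(8,8,q;7)`: every nonzero `αx + β(δx^q + x^{q⁵})` has rank at least `7`. -/
theorem CMPZ_code_eight
    (Fq F : Type*) [Field Fq] [Fintype Fq] [Field F] [Fintype F] [Algebra Fq F]
    (hn : Module.finrank Fq F = 8) (hq : Odd (Fintype.card Fq))
    (δ : F) (hδ : δ ^ 2 = -1) :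
    ∀ α β : F, ¬(α = 0 ∧ β = 0) →
      7 ≤ qrank Fq (fun j : Fin 8 =>
        if (j : ℕ) = 0 then α else
        if (j : ℕ) = 1 then β * δ else
        if (j : ℕ) = 5 then β else 0) := by
  intro α β hαβ
  have h2 : (2 : F) ≠ 0 := by
    intro h2
    have h2q : (2 : Fq) = 0 := by
      apply (algebraMap Fq F).injective
      rw [map_ofNat, map_zero]; exact h2
    have hc : ((Fintype.card Fq : ℕ) : Fq) = 0 := FiniteField.cast_card_eq_zero Fq
    obtain ⟨k, hk⟩ := hq
    rw [hk] at hc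
    push_cast at hc
    rw [h2q] at hc
    simp at hc
  let s : F →ₐ[Fq] F := FiniteField.frobeniusAlgHom Fq F
  have hs : ∀ x, s x = x ^ Fintype.card Fq := fun x => rfl
  have h8 : ∀ x, s (s (s (s (s (s (s (s x))))))) = x := by
    intro x
    have hc : Fintype.card F = Fintype.card Fq ^ 8 := by
      rw [← hn]; exact Module.card_eq_pow_finrank
    have := FiniteField.pow_card x
    rw [hc] at this
    refine Eq.trans ?_ this
    simp only [hs, ← pow_mul]
    congr 1
    ring
  let L : F →ₗ[Fq] F := LinearMap.mulLeft Fq α + (LinearMap.mulLeft Fq (β * δ)).comp s.toLinearMap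
    + (LinearMap.mulLeft Fq β).comp (s.comp (s.comp (s.comp (s.comp s)))).toLinearMap
  have hL : ∀ x, L x = α * x + β * δ * s x + β * s (s (s (s (s x)))) := fun x => rfl
  have hrange : qeval Fq (fun j : Fin 8 =>
        if (j : ℕ) = 0 then α else
        if (j : ℕ) = 1 then β * δ else
        if (j : ℕ) = 5 then β else 0) = L := by
    funext x
    rw [hL]
    simp only [hs, ← pow_mul, qeval, Fin.sum_univ_eight]
    simp
    ring_nf
    simp
  have hker : Module.finrank Fq (LinearMap.ker L) ≤ 1 := by
    by_cases hbot : LinearMap.ker L = ⊥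
    · rw [hbot]; simp
    obtain ⟨x, hxk, hx⟩ := Submodule.exists_mem_ne_zero_of_ne_bot hbot
    refine finrank_le_one (⟨x, hxk⟩ : LinearMap.ker L) ?_
    rintro ⟨y, hyk⟩
    rw [LinearMap.mem_ker, hL] at hxk hyk
    obtain ⟨l, rfl⟩ : ∃ l, y = l * x := ⟨y / x, by field_simp⟩
    have hβ : β ≠ 0 := by
      rintro rfl
      apply hαβ
      simpa [hx] using hxk
    have hl : s l = l := by
      refine qaux_core (s : F →+* F) h8 h2 δ hδ x l hx ?_
      apply mul_left_cancel₀ hβ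
      simp only [RingHom.coe_coe]
      linear_combination hyk - l * hxk
    obtain ⟨c, hc⟩ := qaux_fixed Fq F l hl
    refine ⟨c, ?_⟩
    ext
    simp [Algebra.smul_def, hc]
  have hrn := LinearMap.finrank_range_add_finrank_ker L
  unfold qrank
  rw [hrange, ← LinearMap.coe_range, Submodule.span_eq]
  omega
end

section
/- Let q be an odd prime power and let s be a positive integer with gcd(s,7) = 1. Then C₃ = ⟨x, x^{q^s}, x^{q^{3s}}⟩_{F_{q^7}} is an F_q-linear MRD code with parameters (7,7,q;5); equivalently, every nonzero q-polynomial a x + b x^{q^s} + c x^{q^{3s}} with a, b, c ∈ F_{q^7} has rank at least 5 as an F_q-linear map of F_{q^7}. -/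
theorem csm_lem1 {K L : Type*} [Field K] [Field L] [Algebra K L] (σ : L →ₐ[K] L)
    (hfix : ∀ x, σ x = x → ∃ t : K, algebraMap K L t = x)
    (V : Submodule K L) [FiniteDimensional K L] (hV : 2 ≤ Module.finrank K V) (e0 e1 : L)
    (h : ∀ x ∈ V, e0 * x + e1 * σ x = 0) : e0 = 0 ∧ e1 = 0 := by
  have hne : V ≠ ⊥ := by
    rintro rfl
    simp at hV
  obtain ⟨x, hx, hx0⟩ := V.ne_bot_iff.mp hne
  have hσx : σ x ≠ 0 := by simpa using hx0
  have h1 := h x hx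
  by_cases he : e1 = 0
  · subst he
    simp [hx0] at h1
    exact ⟨h1, rfl⟩
  exfalso
  have hle : V ≤ Submodule.span K {x} := by
    intro y hy
    have h2 := h y hy
    have h3 : σ (y / x) = y / x := by
      rw [map_div₀, div_eq_div_iff hσx hx0]
      have : e1 * (σ y * x - y * σ x) = 0 := by linear_combination x * h2 - y * h1
      rcases mul_eq_zero.mp this with h | h
      · exact absurd h he
      · linear_combination h
    obtain ⟨t, ht⟩ := hfix _ h3
    rw [Submodule.mem_span_singleton]
    refine ⟨t, ?_⟩
    rw [Algebra.smul_def, ht]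
    field_simp
  have := Submodule.finrank_mono hle
  rw [finrank_span_singleton hx0] at this
  omega

theorem csm_lem2 {K L : Type*} [Field K] [Field L] [Algebra K L] (σ : L →ₐ[K] L)
    (hfix : ∀ x, σ x = x → ∃ t : K, algebraMap K L t = x)
    (V : Submodule K L) [FiniteDimensional K L] (hV : 3 ≤ Module.finrank K V) (e0 e1 e2 : L)
    (h : ∀ x ∈ V, e0 * x + e1 * σ x + e2 * σ (σ x) = 0) : e0 = 0 ∧ e1 = 0 ∧ e2 = 0 := by
  have hne : V ≠ ⊥ := by
    rintro rfl
    simp at hV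
  obtain ⟨x, hx, hx0⟩ := V.ne_bot_iff.mp hne
  have hσx : σ x ≠ 0 := by simpa using hx0
  have hσσx : σ (σ x) ≠ 0 := by simpa using hx0
  let T : L →ₗ[K] L := (σ.toLinearMap - LinearMap.id) ∘ₗ LinearMap.mulLeft K x⁻¹
  have hT : ∀ v, T v = σ (x⁻¹ * v) - x⁻¹ * v := fun v => rfl
  have hker : LinearMap.ker (T.domRestrict V) ≤ Submodule.span K {(⟨x, hx⟩ : V)} := by
    rintro ⟨y, hy⟩ hk
    have h3 : σ (x⁻¹ * y) = x⁻¹ * y := by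
      have : T y = 0 := hk
      rw [hT] at this
      exact sub_eq_zero.mp this
    obtain ⟨t, ht⟩ := hfix _ h3
    rw [Submodule.mem_span_singleton]
    refine ⟨t, Subtype.ext ?_⟩
    change t • x = y
    rw [Algebra.smul_def, ht]
    field_simp
  have h1 := Submodule.finrank_mono hker
  rw [finrank_span_singleton (by simpa [Subtype.ext_iff] using hx0)] at h1
  have h2 := LinearMap.finrank_range_add_finrank_ker (T.domRestrict V)
  have key := csm_lem1 σ hfix (LinearMap.range (T.domRestrict V)) (by omega)
    (e1 * σ x + e2 * σ (σ x)) (e2 * σ (σ x)) (by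
      rintro _ ⟨⟨y, hy⟩, rfl⟩
      change (e1 * σ x + e2 * σ (σ x)) * T y + (e2 * σ (σ x)) * σ (T y) = 0
      have hy' := h y hy
      have hx' := h x hx
      obtain ⟨w, rfl⟩ : ∃ w, y = x * w := ⟨x⁻¹ * y, by field_simp⟩
      have : T (x * w) = σ w - w := by
        rw [hT, inv_mul_cancel_left₀ hx0]
      rw [this]
      simp only [map_mul, map_sub] at *
      linear_combination hy' - w * hx')
  have he2 : e2 = 0 := by simpa [hσσx] using key.2
  subst he2
  have he1 : e1 = 0 := by simpa [hσx] using key.1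
  subst he1
  have := h x hx
  exact ⟨by simpa [hx0] using this, rfl, rfl⟩

theorem csm_main {K L : Type*} [Field K] [Field L] [Algebra K L] (σ : L →ₐ[K] L)
    (hfix : ∀ x, σ x = x → ∃ t : K, algebraMap K L t = x)
    (h7 : ∀ x, σ (σ (σ (σ (σ (σ (σ x)))))) = x) (h20 : (2 : L) ≠ 0)
    (V : Submodule K L) [FiniteDimensional K L] (hV : 3 ≤ Module.finrank K V) (a b c : L)
    (h : ∀ x ∈ V, a * x + b * σ x + c * σ (σ (σ x)) = 0) : a = 0 ∧ b = 0 ∧ c = 0 := by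
  by_cases hc : c = 0
  · subst hc
    have := csm_lem2 σ hfix V hV a b 0 (fun x hx => by simpa using h x hx)
    exact ⟨this.1, this.2.1, rfl⟩
  exfalso
  obtain ⟨B, hB⟩ : ∃ B, B = - b / c := ⟨_, rfl⟩
  obtain ⟨C, hC⟩ : ∃ C, C = - a / c := ⟨_, rfl⟩
  have h3 : ∀ x ∈ V, σ (σ (σ x)) = B * σ x + C * x := by
    intro x hx
    rw [hB, hC]
    field_simp
    linear_combination h x hx
  have key := csm_lem2 σ hfix V hV
    (σ (σ (σ (σ B))) * σ (σ B) * C - 1)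
    (σ (σ (σ (σ C))) * σ C + σ (σ (σ (σ B))) * σ (σ B) * B)
    (σ (σ (σ (σ B))) * σ (σ C) + σ (σ (σ (σ C))) * σ B) (by
      intro x hx
      have e3 := h3 x hx
      have e4 := congrArg σ e3
      have e5 := congrArg σ e4
      have e6 := congrArg σ e5
      have e7 := congrArg σ e6
      rw [h7] at e7
      simp only [map_mul, map_add] at e4 e5 e6 e7
      rw [e5, e4, e3] at e7
      linear_combination -e7)
  obtain ⟨k0, -, k2⟩ := key
  have k0' : σ (σ (σ (σ B))) * σ (σ B) * C = 1 := by linear_combination k0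
  have j2 := congrArg (fun z => σ (σ z)) k0'
  have j4 := congrArg (fun z => σ (σ z)) j2
  simp only [map_mul, map_one, h7] at j2 j4
  -- j2 : B6 B4 C2 = 1 ; j4 : B1 B6 C4 = 1
  apply h20
  have := congrArg (fun z => σ (σ (σ (σ (σ (σ B))))) * z) k2
  simp only [mul_zero] at this
  linear_combination this - j2 - j4

/-- Csajbók–Marino–Polverino–Zhou: for `q` odd and `gcd(s,7) = 1`,
`C₃ = ⟨x, x^{q^s}, x^{q^{3s}}⟩_{F_{q⁷}}` is an MRD code with parameters `(7,7,q;5)`: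
every nonzero `ax + bx^{q^s} + cx^{q^{3s}}` has rank at least `5`. -/
theorem CsMPZh_code_seven
    (Fq F : Type*) [Field Fq] [Fintype Fq] [Field F] [Fintype F] [Algebra Fq F]
    (hn : Module.finrank Fq F = 7) (hq : Odd (Fintype.card Fq))
    (s : ℕ) (hs : 0 < s) (hgcd : Nat.gcd s 7 = 1) :
    ∀ a b c : F, ¬(a = 0 ∧ b = 0 ∧ c = 0) →
      5 ≤ qrank Fq (fun j : Fin 7 =>
        if (j : ℕ) = 0 then a else
        if (j : ℕ) = s % 7 then b else
        if (j : ℕ) = (3 * s) % 7 then c else 0) := by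
  intro a b c habc
  have : FiniteDimensional Fq F := Module.finite_of_finrank_pos (by omega)
  have hcard : Fintype.card F = Fintype.card Fq ^ 7 := by
    rw [Module.card_eq_pow_finrank (K := Fq), hn]
  have hφ7 : ∀ x : F, x ^ Fintype.card Fq ^ 7 = x := fun x => by
    rw [← hcard]; exact FiniteField.pow_card x
  have hφ7k : ∀ (k : ℕ) (x : F), x ^ Fintype.card Fq ^ (7 * k) = x := fun k x => by
    rw [pow_mul, ← hcard]; exact FiniteField.pow_card_pow k x
  have hmod : ∀ (m : ℕ) (x : F), x ^ Fintype.card Fq ^ (m % 7) = x ^ Fintype.card Fq ^ m := by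
    intro m x
    conv_rhs => rw [← Nat.mod_add_div m 7, pow_add, pow_mul, hφ7k]
  let φ : F →ₐ[Fq] F := FiniteField.frobeniusAlgHom Fq F
  have hφ : ⇑φ = (· ^ Fintype.card Fq) := rfl
  let σ : F →ₐ[Fq] F := φ ^ s
  have hσ : ∀ x, σ x = x ^ Fintype.card Fq ^ s := by
    intro x
    change (φ ^ s) x = _
    rw [AlgHom.coe_pow, hφ, pow_iterate]
  have hfix : ∀ x, σ x = x → ∃ t : Fq, algebraMap Fq F t = x := by
    intro x hx
    have p1 : Function.IsPeriodicPt (· ^ Fintype.card Fq : F → F) s x := by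
      rw [Function.IsPeriodicPt, pow_iterate]
      rw [hσ] at hx
      exact hx
    have p2 : Function.IsPeriodicPt (· ^ Fintype.card Fq : F → F) 7 x := by
      rw [Function.IsPeriodicPt, pow_iterate]
      exact hφ7 x
    have p := p1.gcd p2
    rw [hgcd] at p
    have := (IsGalois.mem_range_algebraMap_iff_fixed (F := Fq) (E := F) x).2 (by
      intro f
      obtain ⟨n, rfl⟩ := (FiniteField.bijective_frobeniusAlgEquivOfAlgebraic_pow Fq F).2 f
      simp only [AlgEquiv.coe_pow, FiniteField.coe_frobeniusAlgEquivOfAlgebraic]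
      have := p.const_mul n.1
      rw [mul_one] at this
      exact this)
    exact this
  have h7 : ∀ x, σ (σ (σ (σ (σ (σ (σ x)))))) = x := by
    intro x
    simp only [hσ, ← pow_mul, ← pow_add]
    rw [show s + s + s + s + s + s + s = 7 * s by ring, hφ7k]
  have h20 : (2 : F) ≠ 0 := by
    intro h2
    have hF : Odd (Fintype.card F) := by rw [hcard]; exact hq.pow
    have : ringChar F ≠ 2 := by
      intro hc
      have := FiniteField.even_card_of_char_two hc
      rw [Nat.odd_iff] at hF
      omega
    exact Ring.two_ne_zero this h2
  let T : F →ₗ[Fq] F := LinearMap.mulLeft Fq a + LinearMap.mulLeft Fq b ∘ₗ σ.toLinearMap +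
    LinearMap.mulLeft Fq c ∘ₗ σ.toLinearMap ∘ₗ σ.toLinearMap ∘ₗ σ.toLinearMap
  have hT : ∀ x, T x = a * x + b * σ x + c * σ (σ (σ x)) := fun x => rfl
  have hq : qeval Fq (fun j : Fin 7 =>
        if (j : ℕ) = 0 then a else
        if (j : ℕ) = s % 7 then b else
        if (j : ℕ) = (3 * s) % 7 then c else 0) = T := by
    funext x
    rw [hT]
    have e1 : σ x = x ^ Fintype.card Fq ^ (s % 7) := by rw [hmod, hσ]
    have e3 : σ (σ (σ x)) = x ^ Fintype.card Fq ^ ((3 * s) % 7) := by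
      rw [hmod]
      simp only [hσ, ← pow_mul, ← pow_add]
      congr 2
      ring
    rw [e3, e1]
    clear e1 e3
    have h0 : s % 7 ≠ 0 := by
      intro h
      rw [Nat.gcd_eq_right (Nat.dvd_of_mod_eq_zero h)] at hgcd
      omega
    have hlt : s % 7 < 7 := Nat.mod_lt _ (by norm_num)
    have h3 : (3 * s) % 7 = (3 * (s % 7)) % 7 := by omega
    rw [h3]
    generalize s % 7 = r at *
    unfold qeval
    have hpos : 1 ≤ r := Nat.one_le_iff_ne_zero.mpr h0
    clear h0
    interval_cases r <;> simp [Fin.sum_univ_seven] <;> ring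
  unfold qrank
  rw [hq]
  have hspan : Submodule.span Fq (Set.range T) = LinearMap.range T := by
    rw [← LinearMap.coe_range, Submodule.span_eq]
  rw [hspan]
  by_contra hlt
  have hrn := LinearMap.finrank_range_add_finrank_ker T
  exact habc (csm_main σ hfix h7 h20 (LinearMap.ker T) (by omega) a b c
    (fun x hx => by rw [← hT]; exact hx))
end

section
/- Let q be a prime power with q ≡ 1 (mod 3) and let s be a positive integer with gcd(s,8) = 1. Then C₄ = ⟨x, x^{q^s}, x^{q^{3s}}⟩_{F_{q^8}} is an F_q-linear MRD code with parameters (8,8,q;6); equivalently, every nonzero q-polynomial a x + b x^{q^s} + c x^{q^{3s}} with a, b, c ∈ F_{q^8} has rank at least 6 as an F_q-linear map of F_{q^8}. -/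
theorem aux_L1 {F : Type*} [Field F] (σ : F →+* F) (x y c d : F)
    (hind : ∀ α β : F, σ α = α → σ β = β → α * x + β * y = 0 → α = 0 ∧ β = 0)
    (hx : c * x + d * σ x = 0) (hy : c * y + d * σ y = 0) : c = 0 ∧ d = 0 := by
  have hx0 : x ≠ 0 := by
    rintro rfl
    have := (hind 1 0 (by simp) (by simp) (by simp)).1
    exact one_ne_zero this
  by_cases hd : d = 0
  · subst hd
    simp [hx0] at hx
    exact ⟨hx, rfl⟩
  · exfalso
    have hsx : σ x ≠ 0 := by simpa using hx0
    have h1 : σ y * x = y * σ x := by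
      apply mul_left_cancel₀ hd
      linear_combination x * hy - y * hx
    have h2 : σ (y / x) = y / x := by
      rw [map_div₀]; field_simp; linear_combination h1
    have := (hind (- (y / x)) 1 (by rw [map_neg, h2]) (by simp) (by field_simp; ring)).2
    exact one_ne_zero this

theorem aux_L2 {F : Type*} [Field F] (σ : F →+* F) (x y z p q r : F)
    (hind : ∀ α β γ : F, σ α = α → σ β = β → σ γ = γ → α * x + β * y + γ * z = 0 →
      α = 0 ∧ β = 0 ∧ γ = 0)
    (hx : p * x + q * σ x + r * σ (σ x) = 0) (hy : p * y + q * σ y + r * σ (σ y) = 0)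
    (hz : p * z + q * σ z + r * σ (σ z) = 0) : p = 0 ∧ q = 0 ∧ r = 0 := by
  have hx0 : x ≠ 0 := by
    rintro rfl
    have := (hind 1 0 0 (by simp) (by simp) (by simp) (by simp)).1
    exact one_ne_zero this
  have hsx : σ x ≠ 0 := by simpa using hx0
  have hssx : σ (σ x) ≠ 0 := by simpa using hx0
  obtain ⟨w, rfl⟩ : ∃ w, y = x * w := ⟨y / x, by field_simp⟩
  obtain ⟨t, rfl⟩ : ∃ t, z = x * t := ⟨z / x, by field_simp⟩
  simp only [map_mul] at hy hz
  have key := aux_L1 σ (σ w - w) (σ t - t) (q * σ x + r * σ (σ x)) (r * σ (σ x)) ?_ ?_ ?_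
  · obtain ⟨h1, h2⟩ := key
    have hr : r = 0 := by simpa [hx0] using h2
    subst hr
    have hq : q = 0 := by simpa [hx0] using h1
    subst hq
    simpa [hx0] using hx
  · intro α β hα hβ h
    have := hind (-(α * w + β * t)) α β ?_ hα hβ (by ring)
    · exact this.2
    · simp only [map_neg, map_add, map_mul, hα, hβ]
      linear_combination - h
  · simp only [map_sub]
    linear_combination hy - w * hx
  · simp only [map_sub]
    linear_combination hz - t * hx

theorem aux_eq {F : Type*} [Field F] (σ : F →+* F)
    (h8 : ∀ x, σ (σ (σ (σ (σ (σ (σ (σ x))))))) = x) (A B u : F)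
    (hu : σ (σ (σ u)) = A * u + B * σ u) :
    ((σ (σ (σ (σ (σ B)))) * σ (σ (σ A)) + σ (σ (σ (σ (σ A)))) * σ (σ B)) * A - 1) * u +
    (σ (σ (σ (σ (σ B)))) * σ (σ (σ B)) * σ A +
      (σ (σ (σ (σ (σ B)))) * σ (σ (σ A)) + σ (σ (σ (σ (σ A)))) * σ (σ B)) * B) * σ u +
    (σ (σ (σ (σ (σ A)))) * σ (σ A) + σ (σ (σ (σ (σ B)))) * σ (σ (σ B)) * σ B) * σ (σ u) = 0 := by
  have h := h8 u
  simp only [hu, map_add, map_mul] at h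
  linear_combination h

theorem aux_core {F : Type*} [Field F] (σ : F →+* F)
    (h8 : ∀ x, σ (σ (σ (σ (σ (σ (σ (σ x))))))) = x) (h3 : (3 : F) ≠ 0)
    (hroot : ∀ z : F, z ^ 3 = 1 → σ z = z) (x y z A B : F)
    (hind : ∀ α β γ : F, σ α = α → σ β = β → σ γ = γ → α * x + β * y + γ * z = 0 →
      α = 0 ∧ β = 0 ∧ γ = 0)
    (hx : σ (σ (σ x)) = A * x + B * σ x) (hy : σ (σ (σ y)) = A * y + B * σ y)
    (hz : σ (σ (σ z)) = A * z + B * σ z) : False := by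
  obtain ⟨e1, e2, -⟩ := aux_L2 σ x y z _ _ _ hind (aux_eq σ h8 A B x hx)
    (aux_eq σ h8 A B y hy) (aux_eq σ h8 A B z hz)
  obtain ⟨v, hv⟩ : ∃ v, v = A * σ (σ (σ (σ (σ A)))) * σ (σ B) := ⟨_, rfl⟩
  have hw : σ (σ (σ v)) = σ (σ (σ A)) * A * σ (σ (σ (σ (σ B)))) := by
    simp only [hv, map_mul, h8]
  have hvw : v + σ (σ (σ v)) = 1 := by
    rw [hw, hv]; linear_combination e1
  have h6 : σ (σ (σ (σ (σ (σ v))))) = v := by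
    have := congrArg (fun t => σ (σ (σ t))) hvw
    simp only [map_add, map_one] at this
    linear_combination this - hvw
  have h2 : σ (σ v) = v := by
    have := h8 v
    rwa [h6] at this
  rw [h2] at hvw hw
  have hb : σ (σ (σ (σ (σ (σ v))))) =
      σ (σ (σ (σ (σ (σ A))))) * σ (σ (σ A)) * B := by
    simp only [hv, map_mul, h8]
  rw [h6] at hb
  have hb3 : σ v = σ A * σ (σ (σ (σ (σ (σ A))))) * σ (σ (σ B)) := by
    simp only [hv, map_mul]
  have hq : σ v * σ v + v = 0 := by
    have e2' : σ (σ (σ (σ (σ B)))) * σ (σ (σ B)) * σ A * A + B = 0 := by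
      linear_combination A * e2 - B * e1
    calc σ v * σ v + v = (σ A * σ (σ (σ (σ (σ (σ A))))) * σ (σ (σ B))) *
          (σ (σ (σ A)) * A * σ (σ (σ (σ (σ B))))) +
          σ (σ (σ (σ (σ (σ A))))) * σ (σ (σ A)) * B := by rw [← hb3, ← hw, ← hb]
      _ = 0 := by linear_combination σ (σ (σ (σ (σ (σ A))))) * σ (σ (σ A)) * e2'
  have hz3 : (-σ v) ^ 3 = 1 := by
    linear_combination (-σ v - 1) * hq + (1 + σ v) * hvw
  have hfix := hroot _ hz3
  rw [map_neg, h2] at hfix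
  have hvv : σ v = v := by linear_combination hfix
  rw [hvv] at hvw hq
  apply h3
  linear_combination 4 * hq - (2 * v + 3) * hvw

theorem aux_main {Fq F : Type*} [Field Fq] [Field F] [Algebra Fq F]
    (hn : Module.finrank Fq F = 8) (σ : F →ₐ[Fq] F)
    (h8 : ∀ x, σ (σ (σ (σ (σ (σ (σ (σ x))))))) = x) (h3 : (3 : F) ≠ 0)
    (hroot : ∀ z : F, z ^ 3 = 1 → σ z = z)
    (hfix : ∀ z : F, σ z = z → ∃ t : Fq, algebraMap Fq F t = z)
    (a b c : F) (habc : ¬(a = 0 ∧ b = 0 ∧ c = 0)) :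
    6 ≤ Module.finrank Fq (Submodule.span Fq
      (Set.range (fun x => a * x + b * σ x + c * σ (σ (σ x))))) := by
  have : FiniteDimensional Fq F := Module.finite_of_finrank_pos (by omega)
  let L : F →ₗ[Fq] F := LinearMap.mulLeft Fq a + (LinearMap.mulLeft Fq b).comp σ.toLinearMap +
    (LinearMap.mulLeft Fq c).comp (σ.toLinearMap.comp (σ.toLinearMap.comp σ.toLinearMap))
  have hL : ∀ x, L x = a * x + b * σ x + c * σ (σ (σ x)) := fun x => rfl
  have hspan : Submodule.span Fq
      (Set.range (fun x => a * x + b * σ x + c * σ (σ (σ x)))) = LinearMap.range L := by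
    have : (Set.range (fun x => a * x + b * σ x + c * σ (σ (σ x)))) = LinearMap.range L := by
      ext x; simp [hL]
    rw [this, Submodule.span_eq]
  rw [hspan]
  have hrn := LinearMap.finrank_range_add_finrank_ker L
  by_contra hlt
  have hk : 3 ≤ Module.finrank Fq (LinearMap.ker L) := by omega
  obtain ⟨f, hf⟩ := exists_linearIndependent_of_le_finrank hk
  have hf' : LinearIndependent Fq (fun i => (f i : F)) :=
    hf.map' (LinearMap.ker L).subtype (Submodule.ker_subtype _)
  have hker : ∀ i, a * (f i : F) + b * σ (f i) + c * σ (σ (σ (f i))) = 0 := fun i => by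
    rw [← hL]; exact (f i).2
  have hind : ∀ α β γ : F, σ α = α → σ β = β → σ γ = γ →
      α * (f 0 : F) + β * (f 1) + γ * (f 2) = 0 → α = 0 ∧ β = 0 ∧ γ = 0 := by
    intro α β γ hα hβ hγ h
    obtain ⟨α, rfl⟩ := hfix α hα
    obtain ⟨β, rfl⟩ := hfix β hβ
    obtain ⟨γ, rfl⟩ := hfix γ hγ
    have := Fintype.linearIndependent_iff.1 hf' ![α, β, γ] (by
      simpa [Fin.sum_univ_three, Algebra.smul_def] using h)
    have h0 := this 0
    have h1 := this 1
    have h2 := this 2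
    simp at h0 h1 h2
    simp [h0, h1, h2]
  by_cases hc : c = 0
  · subst hc
    have := aux_L2 (σ : F →+* F) (f 0) (f 1) (f 2) a b 0 hind
      (by simpa using hker 0) (by simpa using hker 1) (by simpa using hker 2)
    exact habc this
  · have hA : ∀ i, σ (σ (σ (f i : F))) = (-a / c) * (f i : F) + (-b / c) * σ (f i) := by
      intro i
      field_simp
      linear_combination hker i
    exact aux_core (σ : F →+* F) h8 h3 hroot (f 0) (f 1) (f 2) _ _ hind (hA 0) (hA 1) (hA 2)

theorem aux_fix (Fq F : Type*) [Field Fq] [Fintype Fq] [Field F] [Fintype F] [Algebra Fq F]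
    (z : F) (hz : z ^ Fintype.card Fq = z) : ∃ t : Fq, algebraMap Fq F t = z := by
  have : FiniteDimensional Fq F := Module.Finite.of_finite
  have h : z ∈ (⊥ : IntermediateField Fq F) := by
    rw [IsGalois.mem_bot_iff_fixed]
    intro g
    obtain ⟨n, rfl⟩ := (FiniteField.bijective_frobeniusAlgEquivOfAlgebraic_pow Fq F).2 g
    simp only [AlgEquiv.coe_pow]
    exact Function.iterate_fixed hz _
  exact IntermediateField.mem_bot.1 h

theorem aux_final (Fq F : Type*) [Field Fq] [Fintype Fq] [Field F] [Fintype F] [Algebra Fq F]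
    (hn : Module.finrank Fq F = 8) (hq : Fintype.card Fq % 3 = 1)
    (r t m : ℕ) (hrt : r * t = 8 * m + 1) (a b c : F) (habc : ¬(a = 0 ∧ b = 0 ∧ c = 0))
    (g : F → F) (hg : ∀ x, g x =
      a * x + b * x ^ Fintype.card Fq ^ r + c * x ^ Fintype.card Fq ^ (3 * r)) :
    6 ≤ Module.finrank Fq (Submodule.span Fq (Set.range g)) := by
  have : FiniteDimensional Fq F := Module.finite_of_finrank_pos (by omega)
  have hcard : Fintype.card F = Fintype.card Fq ^ 8 := by
    rw [Module.card_eq_pow_finrank (K := Fq), hn]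
  have hpow8 : ∀ (k : ℕ) (x : F), x ^ Fintype.card Fq ^ (8 * k) = x := by
    intro k x
    rw [pow_mul, ← hcard, FiniteField.pow_card_pow]
  let σ : F →ₐ[Fq] F := (FiniteField.frobeniusAlgHom Fq F) ^ r
  have hσ : ∀ x, σ x = x ^ Fintype.card Fq ^ r := by
    intro x
    simp only [σ, AlgHom.coe_pow, FiniteField.coe_frobeniusAlgHom, pow_iterate]
  have hσ3 : ∀ x, σ (σ (σ x)) = x ^ Fintype.card Fq ^ (3 * r) := by
    intro x
    simp only [hσ, ← pow_mul, ← pow_add]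
    congr 2; ring
  have h8 : ∀ x, σ (σ (σ (σ (σ (σ (σ (σ x))))))) = x := by
    intro x
    simp only [hσ, ← pow_mul, ← pow_add]
    conv_rhs => rw [← hpow8 r x]
    congr 2; ring
  have hqs : ∀ k, Fintype.card Fq ^ k % 3 = 1 := by
    intro k
    rw [Nat.pow_mod, hq]; simp
  have h3 : (3 : F) ≠ 0 := by
    intro h
    have h1 : ((Fintype.card Fq : ℕ) : F) = 0 := by
      rw [← map_natCast (algebraMap Fq F), FiniteField.cast_card_eq_zero, map_zero]
    have h2 : Fintype.card Fq = 3 * (Fintype.card Fq / 3) + 1 := by omega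
    rw [h2] at h1
    push_cast at h1
    rw [h] at h1
    simp at h1
  have main := aux_main hn σ h8 h3 ?_ ?_ a b c habc
  · have hgg : g = fun x => a * x + b * σ x + c * σ (σ (σ x)) := by
      funext x
      rw [hg, hσ3, hσ]
    rw [hgg]
    exact main
  · intro z hz
    rw [hσ]
    have h2 : Fintype.card Fq ^ r = 3 * (Fintype.card Fq ^ r / 3) + 1 := by
      have := hqs r
      omega
    rw [h2, pow_succ, pow_mul, hz]; simp
  · intro z hz
    apply aux_fix Fq F z
    have h1 : ∀ k, z ^ Fintype.card Fq ^ (r * k) = z := by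
      intro k
      induction k with
      | zero => simp
      | succ k ih => rw [Nat.mul_succ, pow_add, pow_mul, ih, ← hσ, hz]
    have h2 := h1 t
    rwa [hrt, pow_succ, pow_mul, hpow8] at h2

/-- Csajbók–Marino–Polverino–Zhou: for `q ≡ 1 (mod 3)` and
`gcd(s,8) = 1`, `C₄ = ⟨x, x^{q^s}, x^{q^{3s}}⟩_{F_{q⁸}}` is an MRD code with parameters
`(8,8,q;6)`: every nonzero `ax + bx^{q^s} + cx^{q^{3s}}` has rank at least `6`. -/
theorem CsMPZh_code_eight
    (Fq F : Type*) [Field Fq] [Fintype Fq] [Field F] [Fintype F] [Algebra Fq F]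
    (hn : Module.finrank Fq F = 8) (hq : Fintype.card Fq % 3 = 1)
    (s : ℕ) (hs : 0 < s) (hgcd : Nat.gcd s 8 = 1) :
    ∀ a b c : F, ¬(a = 0 ∧ b = 0 ∧ c = 0) →
      6 ≤ qrank Fq (fun j : Fin 8 =>
        if (j : ℕ) = 0 then a else
        if (j : ℕ) = s % 8 then b else
        if (j : ℕ) = (3 * s) % 8 then c else 0) := by
  intro a b c habc
  have : FiniteDimensional Fq F := Module.finite_of_finrank_pos (by omega)
  have hcard : Fintype.card F = Fintype.card Fq ^ 8 := by
    rw [Module.card_eq_pow_finrank (K := Fq), hn]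
  have hp : ∀ (j k : ℕ) (x : F), x ^ Fintype.card Fq ^ (8 * k + j) = x ^ Fintype.card Fq ^ j := by
    intro j k x
    rw [pow_add, pow_mul, pow_mul, ← hcard, FiniteField.pow_card_pow]
  unfold qrank
  have hodd : s % 2 = 1 := by
    by_contra h
    have : 2 ∣ Nat.gcd s 8 := Nat.dvd_gcd (by omega) (by norm_num)
    omega
  have hcases : s % 8 = 1 ∨ s % 8 = 3 ∨ s % 8 = 5 ∨ s % 8 = 7 := by omega
  rcases hcases with h | h | h | h
  · have h3 : (3 * s) % 8 = 3 := by omega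
    refine aux_final Fq F hn hq 1 1 0 (by norm_num) a b c habc _ ?_
    intro x
    simp [qeval, Fin.sum_univ_eight, h, h3]
  · have h3 : (3 * s) % 8 = 1 := by omega
    refine aux_final Fq F hn hq 3 3 1 (by norm_num) a b c habc _ ?_
    intro x
    have := hp 1 1 x
    norm_num at this
    simp [qeval, Fin.sum_univ_eight, h, h3, this]
    ring
  · have h3 : (3 * s) % 8 = 7 := by omega
    refine aux_final Fq F hn hq 5 5 3 (by norm_num) a b c habc _ ?_
    intro x
    have := hp 7 1 x
    norm_num at this
    simp [qeval, Fin.sum_univ_eight, h, h3, this]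
  · have h3 : (3 * s) % 8 = 5 := by omega
    refine aux_final Fq F hn hq 7 7 6 (by norm_num) a b c habc _ ?_
    intro x
    have := hp 5 2 x
    norm_num at this
    simp [qeval, Fin.sum_univ_eight, h, h3, this]
    ring
end

section
/- Let q be an odd prime power with q ≡ 0 or ±1 (mod 5), and let δ ∈ F_{q^6} satisfy δ² + δ = 1. Then C₅ = ⟨x, x^q + x^{q^3} + δ x^{q^5}⟩_{F_{q^6}} is an F_q-linear MRD code with parameters (6,6,q;5); equivalently, every nonzero q-polynomial α x + β(x^q + x^{q^3} + δ x^{q^5}) with α, β ∈ F_{q^6} has rank at least 5 as an F_q-linear map of F_{q^6}. -/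
lemma core_aux {F : Type*} [Field F] (σ : F →+* F) (h6 : ∀ x, σ (σ (σ (σ (σ (σ x))))) = x)
    (δ : F) (hδ : δ ^ 2 + δ = 1) (hσδ : σ δ = δ) (h2 : (2 : F) ≠ 0) (x0 y0 : F)
    (h : x0 * (σ y0 + σ (σ (σ y0)) + δ * σ (σ (σ (σ (σ y0))))) =
      y0 * (σ x0 + σ (σ (σ x0)) + δ * σ (σ (σ (σ (σ x0)))))) :
    x0 * σ y0 - σ x0 * y0 = 0 := by
  have h1 := congrArg σ h
  have h2' := congrArg σ h1
  have h3 := congrArg σ h2'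
  have h4 := congrArg σ h3
  have h5 := congrArg σ h4
  simp only [map_mul, map_add, hσδ, h6] at h1 h2' h3 h4 h5
  have ex1 : ∃ t, t = σ x0 := ⟨_, rfl⟩
  obtain ⟨x1, hx1⟩ := ex1
  obtain ⟨x2, hx2⟩ : ∃ t, t = σ x1 := ⟨_, rfl⟩
  obtain ⟨x3, hx3⟩ : ∃ t, t = σ x2 := ⟨_, rfl⟩
  obtain ⟨x4, hx4⟩ : ∃ t, t = σ x3 := ⟨_, rfl⟩
  obtain ⟨x5, hx5⟩ : ∃ t, t = σ x4 := ⟨_, rfl⟩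
  have hx6 : σ x5 = x0 := by rw [hx5, hx4, hx3, hx2, hx1, h6]
  obtain ⟨y1, hy1⟩ : ∃ t, t = σ y0 := ⟨_, rfl⟩
  obtain ⟨y2, hy2⟩ : ∃ t, t = σ y1 := ⟨_, rfl⟩
  obtain ⟨y3, hy3⟩ : ∃ t, t = σ y2 := ⟨_, rfl⟩
  obtain ⟨y4, hy4⟩ : ∃ t, t = σ y3 := ⟨_, rfl⟩
  obtain ⟨y5, hy5⟩ : ∃ t, t = σ y4 := ⟨_, rfl⟩
  have hy6 : σ y5 = y0 := by rw [hy5, hy4, hy3, hy2, hy1, h6]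
  simp only [← hx1, ← hx2, ← hx3, ← hx4, ← hx5, ← hy1, ← hy2, ← hy3, ← hy4, ← hy5] at h h1 h2' h3 h4 h5 ⊢
  have hδ0 : δ ≠ 0 := by rintro rfl; simp at hδ
  have hδ1 : δ - 1 ≠ 0 := by
    intro hh
    have : (1 : F) = 0 := by linear_combination hδ - (δ + 2) * hh
    exact one_ne_zero this
  -- S = 0
  have hS : (x0*y1 - x1*y0) + (x3*y4 - x4*y3) = 0 := by
    have e : (2 * (δ - 1)) * ((x0*y1 - x1*y0) + (x3*y4 - x4*y3)) = 0 := by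
      have s0 : (x0*y1 - x1*y0) + (x3*y4 - x4*y3) = δ * ((x5*y0-x0*y5) + (x2*y3-x3*y2)) := by
        linear_combination h + h3
      have s1 : (x1*y2 - x2*y1) + (x4*y5 - x5*y4) = δ * ((x0*y1-x1*y0) + (x3*y4-x4*y3)) := by
        linear_combination h1 + h4
      have s2 : (x2*y3 - x3*y2) + (x5*y0 - x0*y5) = δ * ((x1*y2-x2*y1) + (x4*y5-x5*y4)) := by
        linear_combination h2' + h5
      have hd : δ^3 = 2*δ - 1 := by linear_combination (δ - 1) * hδ
      have : (1 - δ^3) * ((x0*y1 - x1*y0) + (x3*y4 - x4*y3)) = 0 := by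
        linear_combination s0 + δ * s2 + δ^2 * s1
      rw [hd] at this
      linear_combination -this
    exact (mul_eq_zero.mp e).resolve_left (mul_ne_zero h2 hδ1)
  obtain ⟨a, ha⟩ : ∃ t, t = x0*y1 - x1*y0 := ⟨_, rfl⟩
  obtain ⟨b, hb⟩ : ∃ t, t = x1*y2 - x2*y1 := ⟨_, rfl⟩
  obtain ⟨c, hc⟩ : ∃ t, t = x2*y3 - x3*y2 := ⟨_, rfl⟩
  have hσa : σ a = b := by rw [ha, hb]; simp only [map_sub, map_mul, ← hx1, ← hx2, ← hy1, ← hy2]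
  have hσb : σ b = c := by rw [hb, hc]; simp only [map_sub, map_mul, ← hx3, ← hx2, ← hy3, ← hy2]
  have hA3 : x3*y4 - x4*y3 = -a := by rw [ha]; linear_combination hS
  have hσc : σ c = -a := by
    rw [hc, ← hA3]; simp only [map_sub, map_mul, ← hx3, ← hx4, ← hy3, ← hy4]
  have hA4 : x4*y5 - x5*y4 = -b := by
    rw [← hσa, ← map_neg, ← hA3]; simp only [map_sub, map_mul, ← hx5, ← hx4, ← hy5, ← hy4]
  have hA5 : x5*y0 - x0*y5 = -c := by
    rw [← hσb, ← map_neg, ← hA4]; simp only [map_sub, map_mul, ← hx5, hx6, ← hy5, hy6]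
  have hB0 : x0*y3 - x3*y0 = -δ*c - a := by rw [ha]; linear_combination h + δ * hA5
  have hB1 : x1*y4 - x4*y1 = δ*a - b := by rw [ha, hb]; linear_combination h1
  have hB2 : x2*y5 - x5*y2 = δ*b - c := by rw [hc, hb]; linear_combination h2'
  rw [← ha]
  by_contra ha0
  obtain ⟨C0, hC0⟩ : ∃ t, t = x0*y2 - x2*y0 := ⟨_, rfl⟩
  obtain ⟨C1, hC1⟩ : ∃ t, t = x1*y3 - x3*y1 := ⟨_, rfl⟩
  obtain ⟨C2, hC2⟩ : ∃ t, t = x2*y4 - x4*y2 := ⟨_, rfl⟩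
  obtain ⟨C4, hC4⟩ : ∃ t, t = x4*y0 - x0*y4 := ⟨_, rfl⟩
  have l0 : (δ*a - b) * C0 - a * C2 + b * C4 = 0 := by
    rw [← hB1, ha, hb, hC0, hC2, hC4]; ring
  have l2 : -a * C0 + (δ*c + a) * C2 - c * C4 = 0 := by
    rw [← hA3, show δ*c + a = -(x0*y3 - x3*y0) by rw [hB0]; ring, hc, hC0, hC2, hC4]; ring
  have l4 : b * C0 - c * C2 + (c - δ*b) * C4 = 0 := by
    have e1 : b = -(x4*y5 - x5*y4) := by rw [hA4]; ring
    have e2 : c = -(x5*y0 - x0*y5) := by rw [hA5]; ring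
    have e3 : c - δ * b = -(x2*y5 - x5*y2) := by rw [hB2]; ring
    rw [e3, e1, e2, hC0, hC2, hC4]; ring
  have p0 : a * c - C0 * C1 + (-δ*c - a) * b = 0 := by
    rw [← hB0, ha, hb, hc, hC0, hC1]; ring
  have hba : δ * a - b ≠ 0 := by
    intro hh
    have e1 : b = δ * a := by linear_combination -hh
    have e2 : c = δ * b := by rw [← hσb, e1, map_mul, hσδ, hσa, e1]
    have e3 : -a = δ * c := by rw [← hσc, e2, map_mul, hσδ, hσb, e2]
    have : (2 * δ) * a = 0 := by
      linear_combination -e3 - δ * e2 - δ^2 * e1 - (δ - 1) * a * hδ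
    exact (mul_ne_zero (mul_ne_zero h2 hδ0) ha0) this
  have hcb : δ * b - c ≠ 0 := by
    have := (map_ne_zero σ).mpr hba
    simpa only [map_sub, map_mul, hσδ, hσa, hσb] using this
  have hac : δ * c + a ≠ 0 := by
    have := (map_ne_zero σ).mpr hcb
    simpa only [map_sub, map_mul, hσδ, hσc, hσb, sub_neg_eq_add] using this
  have hC0z : C0 = 0 := by
    have e : (δ - 1) * ((δ*a-b) * (δ*b-c) * (δ*c+a)) * C0 = 0 := by
      have e0 : ((δ*a - b) * ((δ*c+a)*(c-δ*b) - c^2) + a * (-a*(c-δ*b) + c*b)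
          + b * (a*c - b*(δ*c+a))) * C0 = 0 := by
        linear_combination ((δ*c+a)*(c-δ*b) - c^2) * l0 + (a*(c-δ*b) - b*c) * l2
          + (a*c - b*(δ*c+a)) * l4
      linear_combination -δ * e0 - (δ - 1) * a * b * c * C0 * hδ
    exact (mul_eq_zero.mp e).resolve_left (mul_ne_zero hδ1 (mul_ne_zero (mul_ne_zero hba hcb) hac))
  have p0' : a * c - δ * b * c - a * b = 0 := by
    rw [hC0z] at p0; linear_combination p0
  have p1 : -a * b + δ * a * c - b * c = 0 := by
    have := congrArg σ p0'
    simp only [map_sub, map_mul, map_zero, hσδ, hσa, hσb, hσc] at this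
    linear_combination this
  have p2 : -b * c - δ * a * b + a * c = 0 := by
    have := congrArg σ p1
    simp only [map_sub, map_add, map_neg, map_mul, map_zero, hσδ, hσa, hσb, hσc] at this
    linear_combination this
  have hb0 : b ≠ 0 := by rw [← hσa]; exact (map_ne_zero σ).mpr ha0
  have hca : c = a := by
    have : ((δ - 1) * b) * (c - a) = 0 := by linear_combination p2 - p0'
    exact sub_eq_zero.mp ((mul_eq_zero.mp this).resolve_left (mul_ne_zero hδ1 hb0))
  have hbna : b = -a := by rw [← hσa, ← hca, hσc, hca]
  rw [hca, hbna] at p1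
  have : a ^ 2 * (δ + 2) = 0 := by linear_combination p1
  have hd : δ + 2 = 0 := (mul_eq_zero.mp this).resolve_left (pow_ne_zero 2 ha0)
  have : (1 : F) = 0 := by linear_combination hδ - (δ - 1) * hd
  exact one_ne_zero this


lemma delta_fixed {F : Type*} [Field F] (p n : ℕ) [Fact p.Prime] [CharP F p]
    (hq5 : p ^ n % 5 = 0 ∨ p ^ n % 5 = 1 ∨ p ^ n % 5 = 4) (h2 : (2 : F) ≠ 0)
    (δ : F) (hδ : δ ^ 2 + δ = 1) : δ ^ p ^ n = δ := by
  rcases hq5 with h | h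
  · have h5p : 5 ∣ p := Nat.Prime.dvd_of_dvd_pow (by norm_num) (Nat.dvd_of_mod_eq_zero h)
    have hp5 : p = 5 := ((Nat.prime_dvd_prime_iff_eq (by norm_num) Fact.out).mp h5p).symm
    subst hp5
    have h5 : (5 : F) = 0 := by exact_mod_cast CharP.cast_eq_zero F 5
    have : (δ - 2) ^ 2 = 0 := by linear_combination hδ - (δ - 1) * h5
    have : δ = 2 := sub_eq_zero.mp (pow_eq_zero_iff (two_ne_zero) |>.mp this)
    rw [this, ← iterateFrobenius_def, map_ofNat]
  · have : CharP (AlgebraicClosure F) p :=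
      charP_of_injective_algebraMap (algebraMap F (AlgebraicClosure F)).injective p
    apply (algebraMap F (AlgebraicClosure F)).injective
    have h2K : (2 : AlgebraicClosure F) ≠ 0 := by
      have := (map_ne_zero (algebraMap F (AlgebraicClosure F))).mpr h2
      rwa [map_ofNat] at this
    have hd := congrArg (algebraMap F (AlgebraicClosure F)) hδ
    rw [map_pow]
    simp only [map_add, map_pow, map_one] at hd
    generalize algebraMap F (AlgebraicClosure F) δ = d at hd ⊢
    obtain ⟨s, hs⟩ := IsAlgClosed.exists_pow_nat_eq (d ^ 2 - 4) (n := 2) (by norm_num)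
    obtain ⟨z, w, hzw, hsum⟩ : ∃ z w : AlgebraicClosure F, z * w = 1 ∧ z + w = d := by
      refine ⟨(d + s) / 2, (d - s) / 2, ?_, ?_⟩
      · field_simp
        linear_combination -hs
      · field_simp
        ring
    have hroot : d ^ 2 + d - 1 = 0 := by rw [hd]; ring
    have key : ∀ u v : AlgebraicClosure F, u * v = 1 → u + v = d →
        u ^ 5 = 1 ∧ u ^ 4 = v := by
      intro u v huv hu
      have h5 : u ^ 5 = 1 := by
        have e1 : u ^ 2 + 1 = d * u := by rw [← hu]; linear_combination -huv
        have : u^4 + u^3 + u^2 + u + 1 = 0 := by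
          linear_combination (u^2 + 1 + d * u + u) * e1 + u^2 * hroot
        linear_combination (u - 1) * this
      refine ⟨h5, ?_⟩
      linear_combination v * h5 - u^4 * huv
    obtain ⟨hz5, hz4⟩ := key z w hzw hsum
    obtain ⟨hw5, hw4⟩ := key w z (by rw [mul_comm, hzw]) (by rw [add_comm, hsum])
    rw [← hsum, add_pow_char_pow, ← Nat.div_add_mod (p ^ n) 5]
    rcases h with h | h <;> rw [h]
    · simp [pow_add, pow_mul, hz5, hw5]
    · rw [pow_add, pow_add, pow_mul, pow_mul, hz5, hw5, hz4, hw4]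
      simp [add_comm]

lemma fixed_mem {Fq F : Type*} [Field Fq] [Fintype Fq] [Field F] [Algebra Fq F]
    (t : F) (ht : t ^ Fintype.card Fq = t) : ∃ c : Fq, algebraMap Fq F c = t := by
  have h1 : (Polynomial.X ^ Fintype.card Fq - Polynomial.X : Polynomial F) =
      (Polynomial.X ^ Fintype.card Fq - Polynomial.X : Polynomial Fq).map (algebraMap Fq F) := by
    simp
  have hs : (Polynomial.X ^ Fintype.card Fq - Polynomial.X : Polynomial Fq).Splits := by
    have h0 := FiniteField.roots_X_pow_card_sub_X Fq
    rw [Polynomial.splits_iff_card_roots, h0,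
      FiniteField.X_pow_card_sub_X_natDegree_eq Fq Fintype.one_lt_card]
    rfl
  have hm : t ∈ (Polynomial.X ^ Fintype.card Fq - Polynomial.X : Polynomial F).roots := by
    rw [Polynomial.mem_roots (FiniteField.X_pow_card_sub_X_ne_zero F Fintype.one_lt_card)]
    simp [ht]
  rw [h1, hs.roots_map, Multiset.mem_map] at hm
  obtain ⟨c, -, hc⟩ := hm
  exact ⟨c, hc⟩



/-- Csajbók–Marino–Zullo: for `q` odd with `q ≡ 0, ±1 (mod 5)` and
`δ ∈ F_{q⁶}` with `δ² + δ = 1`, the code `C₅ = ⟨x, x^q + x^{q³} + δx^{q⁵}⟩_{F_{q⁶}}` is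
an MRD code with parameters `(6,6,q;5)`: every nonzero `αx + β(x^q + x^{q³} + δx^{q⁵})`
has rank at least `5`. -/
theorem CsMZ_code_six
    (Fq F : Type*) [Field Fq] [Fintype Fq] [Field F] [Fintype F] [Algebra Fq F]
    (hn : Module.finrank Fq F = 6) (hq : Odd (Fintype.card Fq))
    (hq5 : Fintype.card Fq % 5 = 0 ∨ Fintype.card Fq % 5 = 1 ∨ Fintype.card Fq % 5 = 4)
    (δ : F) (hδ : δ ^ 2 + δ = 1) :
    ∀ α β : F, ¬(α = 0 ∧ β = 0) →
      5 ≤ qrank Fq (fun j : Fin 6 =>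
        if (j : ℕ) = 0 then α else
        if (j : ℕ) = 1 then β else
        if (j : ℕ) = 3 then β else
        if (j : ℕ) = 5 then β * δ else 0) := by
  intro α β hαβ
  obtain ⟨p, hpc⟩ := CharP.exists Fq
  obtain ⟨n, hp, hcard⟩ := FiniteField.card Fq p
  have : Fact p.Prime := ⟨hp⟩
  have : CharP F p := charP_of_injective_algebraMap (algebraMap Fq F).injective p
  have h2 : (2 : F) ≠ 0 := by
    intro h
    have h' : ((2 : ℕ) : F) = 0 := by exact_mod_cast h
    rw [CharP.cast_eq_zero_iff F p, Nat.prime_dvd_prime_iff_eq hp Nat.prime_two] at h'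
    rw [hcard, h'] at hq
    have := Nat.Odd.of_mul_left (m := 2) (n := 2 ^ ((n : ℕ) - 1)) (by
      rwa [← pow_succ', Nat.sub_add_cancel n.pos])
    exact absurd this (by decide)
  let φ : F →ₐ[Fq] F := FiniteField.frobeniusAlgHom Fq F
  have hφ : ∀ x, φ x = x ^ Fintype.card Fq := fun x => rfl
  have hσδ : φ δ = δ := by
    rw [hφ, hcard]
    exact delta_fixed p n (by rwa [← hcard]) h2 δ hδ
  have hF : Fintype.card F = Fintype.card Fq ^ 6 := by
    rw [← hn]; exact Module.card_eq_pow_finrank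
  have h6 : ∀ x, φ (φ (φ (φ (φ (φ x))))) = x := by
    intro x
    simp only [hφ, ← pow_mul]
    conv_rhs => rw [← FiniteField.pow_card x, hF]
    congr 1
    ring
  let L : F →ₗ[Fq] F :=
    { toFun := fun x => α * x + β * (φ x + φ (φ (φ x)) + δ * φ (φ (φ (φ (φ x)))))
      map_add' := fun x y => by simp only [map_add]; ring
      map_smul' := fun c x => by
        simp only [RingHom.id_apply, Algebra.smul_def, map_mul, AlgHom.commutes]
        ring }
  have hLdef : ∀ x, L x = α * x + β * (φ x + φ (φ (φ x)) + δ * φ (φ (φ (φ (φ x))))) :=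
    fun x => rfl
  have hL : qeval Fq (fun j : Fin 6 =>
        if (j : ℕ) = 0 then α else
        if (j : ℕ) = 1 then β else
        if (j : ℕ) = 3 then β else
        if (j : ℕ) = 5 then β * δ else 0) = L := by
    funext x
    rw [hLdef]
    simp only [hφ, ← pow_mul]
    simp [qeval, Fin.sum_univ_succ]
    ring
  have hker : Module.finrank Fq (LinearMap.ker L) ≤ 1 := by
    by_cases hbot : ∀ v : LinearMap.ker L, v = 0
    · exact finrank_le_one 0 fun w => ⟨0, by rw [hbot w]; simp⟩
    push Not at hbot
    obtain ⟨⟨y, hy⟩, hy0⟩ := hbot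
    have hy0' : y ≠ 0 := fun h => hy0 (by simpa using h)
    refine finrank_le_one ⟨y, hy⟩ ?_
    rintro ⟨x, hx⟩
    rw [LinearMap.mem_ker, hLdef] at hx hy
    have hβ : β ≠ 0 := by
      intro hβ
      rw [hβ, zero_mul, add_zero] at hy
      exact hαβ ⟨(mul_eq_zero.mp hy).resolve_right hy0', hβ⟩
    have hc := core_aux (φ : F →+* F) h6 δ hδ hσδ h2 x y (by
      apply mul_left_cancel₀ hβ
      simp only [RingHom.coe_coe]
      linear_combination x * hy - y * hx)
    simp only [RingHom.coe_coe] at hc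
    have hφy : φ y ≠ 0 := (map_ne_zero φ).mpr hy0'
    obtain ⟨c, hc'⟩ := fixed_mem (Fq := Fq) (x / y) (by
      rw [← hφ, map_div₀, div_eq_div_iff hφy hy0']
      linear_combination -hc)
    refine ⟨c, Subtype.ext ?_⟩
    simp only [SetLike.mk_smul_mk, Algebra.smul_def, hc']
    field_simp
  have hrank := LinearMap.finrank_range_add_finrank_ker L
  unfold qrank
  rw [hL, ← LinearMap.coe_range, Submodule.span_eq]
  omega
end
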